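/- Let H be a real inner product space, κ > 0, and let γ : ℝ → H be differentiable with ‖γ′(s)‖ = 1 for all s and with γ′ Lipschitz with Lipschitz constant κ. Then for every s with 0 < s ≤ 1/κ one has γ(s) ≠ γ(0), and ‖ (γ(s) − γ(0))/‖γ(s) − γ(0)‖ − γ′(0) ‖ ≤ 2 κ s. -/

import Mathlib

/-- Taylor estimate of order one for a curve whose derivative is Lipschitz. -/
theorem norm_sub_sub_smul_le_of_lipschitz_deriv {E : Type*} [NormedAddCommGroup E]
    [NormedSpace ℝ E] {f f' : ℝ → E} {K : ℝ} (hf : ∀ t, HasDerivAt f (f' t) t)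
    (hlip : ∀ t u, ‖f' t - f' u‖ ≤ K * |t - u|) {s : ℝ} (hs : 0 ≤ s) :
    ‖f s - f 0 - s • f' 0‖ ≤ K * s ^ 2 / 2 := by
  have hg (t : ℝ) : HasDerivAt (fun t => f t - f 0 - t • f' 0) (f' t - f' 0) t :=
    (((hf t).sub_const (f 0)).sub ((hasDerivAt_id t).smul_const (f' 0))).congr_deriv (by simp)
  have hB (t : ℝ) : HasDerivAt (fun t => K * t ^ 2 / 2) (K * t) t := by
    refine (((hasDerivAt_pow 2 t).const_mul K).div_const 2).congr_deriv ?_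
    norm_num
    ring
  refine image_norm_le_of_norm_deriv_right_le_deriv_boundary (a := 0) (b := s)
    (fun t _ => (hg t).continuousAt.continuousWithinAt)
    (fun t _ => (hg t).hasDerivWithinAt) (by simp) hB ?_ ⟨hs, le_rfl⟩
  intro t ht
  simpa [abs_of_nonneg ht.1] using hlip t 0

/-- Normalizing a nonzero vector close to `r • v`, with `v` a unit vector, at most doubles the
relative error. -/
theorem mul_norm_inv_norm_smul_sub_le {E : Type*} [NormedAddCommGroup E] [NormedSpace ℝ E]
    {d v : E} {r : ℝ} (hd : d ≠ 0) (hv : ‖v‖ = 1) (hr : 0 ≤ r) :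
    r * ‖‖d‖⁻¹ • d - v‖ ≤ 2 * ‖d - r • v‖ := by
  have hd' : ‖d‖ ≠ 0 := norm_ne_zero_iff.mpr hd
  have h_radial : ‖(r - ‖d‖) • (‖d‖⁻¹ • d)‖ ≤ ‖d - r • v‖ := by
    have h := abs_norm_sub_norm_le d (r • v)
    rw [norm_smul r, hv, Real.norm_of_nonneg hr, mul_one, abs_sub_comm] at h
    rwa [norm_smul, norm_smul, norm_inv, norm_norm, inv_mul_cancel₀ hd', mul_one,
      Real.norm_eq_abs]
  calc r * ‖‖d‖⁻¹ • d - v‖ = ‖r • (‖d‖⁻¹ • d - v)‖ := by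
        rw [norm_smul, Real.norm_of_nonneg hr]
    _ = ‖(r - ‖d‖) • (‖d‖⁻¹ • d) + (d - r • v)‖ := by
        rw [sub_smul, smul_inv_smul₀ hd', smul_sub]
        congr 1
        abel
    _ ≤ 2 * ‖d - r • v‖ := by linarith [norm_add_le ((r - ‖d‖) • (‖d‖⁻¹ • d)) (d - r • v)]

/-- chord-direction estimate for a unit-speed curve in a real
inner product space `H` whose velocity `γ′` is `κ`-Lipschitz. For every `s`
with `0 < s ≤ 1/κ` one has `γ(s) ≠ γ(0)` and
`‖(γ(s) − γ(0))/‖γ(s) − γ(0)‖ − γ′(0)‖ ≤ 2κs`. -/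
theorem stmt17 {H : Type*} [NormedAddCommGroup H] [InnerProductSpace ℝ H]
    (γ γ' : ℝ → H) (hderiv : ∀ s, HasDerivAt γ (γ' s) s)
    (hunit : ∀ s, ‖γ' s‖ = 1) (κ : ℝ) (hκ : 0 < κ)
    (hlip : ∀ s u, ‖γ' s - γ' u‖ ≤ κ * |s - u|)
    (s : ℝ) (hs0 : 0 < s) (hs1 : s ≤ 1 / κ) :
    γ s ≠ γ 0 ∧
      ‖(‖γ s - γ 0‖)⁻¹ • (γ s - γ 0) - γ' 0‖ ≤ 2 * κ * s := by
  have h_taylor := norm_sub_sub_smul_le_of_lipschitz_deriv hderiv hlip hs0.le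
  have hκs : κ * s ≤ 1 := by rwa [le_div_iff₀ hκ, mul_comm] at hs1
  have hne : γ s ≠ γ 0 := by
    intro h
    rw [h, sub_self, zero_sub, norm_neg, norm_smul, hunit, mul_one,
      Real.norm_of_nonneg hs0.le] at h_taylor
    nlinarith
  refine ⟨hne, le_of_mul_le_mul_left ?_ hs0⟩
  have h_normalize := mul_norm_inv_norm_smul_sub_le (sub_ne_zero.mpr hne) (hunit 0) hs0.le
  have : 0 ≤ κ * s ^ 2 := by positivity
  linarith
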